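/- Let d ≥ 1, let μ ∈ ℝ^d satisfy μ_i < 0 for all 1 ≤ i ≤ d, and let u be an admissible potential derivative. For every M > 0 there exists R > 0 such that for every x ∈ ℝ^d with x_i < 0 for all 1 ≤ i ≤ d and ‖x‖ ≥ R, β_d(x) ≤ −M; that is, β_d(x) → −∞ as ‖x‖ → ∞ within the open negative orthant. -/

import Mathlib

open Filter Real Set

noncomputable section

/-- A function `u : ℝ → ℝ` is an admissible potential derivative. -/
def Admissible (u : ℝ → ℝ) : Prop :=
  Continuous u ∧ (∀ y, 0 ≤ u y) ∧ AntitoneOn u (Set.Iic 0) ∧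
  Tendsto u atTop (nhds 0) ∧ Tendsto u atBot atTop ∧
  ∀ a b : ℝ, 0 < b → b < a → Tendsto (fun y => u (a * y) / u (b * y)) atBot atTop

/-- `∑ k, (μ_k + u(x_k) − u(x_{k−1})) x_k` with the convention `u(x₀) := 0`
(0-based indices: the first summand is `(μ₀ + u(x₀)) x₀`). -/
def betaSum {d : ℕ} (μ : Fin d → ℝ) (u : ℝ → ℝ) (x : Fin d → ℝ) : ℝ :=
  ∑ k, (μ k + u (x k) -
      (if (k : ℕ) = 0 then 0 else u (x ⟨(k : ℕ) - 1, lt_of_le_of_lt (Nat.sub_le _ _) k.isLt⟩)))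
    * x k

/-- The drift functional `β_d(x)`. -/
def beta {d : ℕ} (μ : Fin d → ℝ) (u : ℝ → ℝ) (x : EuclideanSpace ℝ (Fin d)) : ℝ :=
  (1 / ‖x‖) * betaSum μ u x

/-- A function that is monotone on the half-line has a convex primitive there. -/
theorem exists_convex_primitive {v : ℝ → ℝ} (hv : Continuous v) (hm : MonotoneOn v (Ici 0)) :
    ∃ V : ℝ → ℝ, V 0 = 0 ∧ ∀ a z, 0 ≤ a → 0 ≤ z → v a * (z - a) ≤ V z - V a := by
  refine ⟨fun y => ∫ t in (0 : ℝ)..y, v t, by simp, fun a z ha hz => ?_⟩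
  have hi : ∀ p q, IntervalIntegrable v MeasureTheory.volume p q := hv.intervalIntegrable
  simp only [intervalIntegral.integral_interval_sub_left (hi 0 z) (hi 0 a)]
  rcases le_total a z with h | h
  · have := intervalIntegral.integral_mono_on (f := fun _ => v a) h (by simp) (hi a z)
      (fun t ht => hm ha (ha.trans ht.1) ht.1)
    simp only [intervalIntegral.integral_const, smul_eq_mul] at this
    linarith
  · have := intervalIntegral.integral_mono_on (g := fun _ => v a) h (hi z a) (by simp)
      (fun t ht => hm (hz.trans ht.1) ha ht.2)
    simp only [intervalIntegral.integral_const, smul_eq_mul] at this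
    rw [intervalIntegral.integral_symm]
    linarith

/-- The Bregman divergence of the primitive grows superlinearly in `z`, uniformly in `a ≤ z / 2`. -/
theorem bregman_superlinear {v V : ℝ → ℝ} (hm : MonotoneOn v (Ici 0))
    (hV : ∀ a z, 0 ≤ a → 0 ≤ z → v a * (z - a) ≤ V z - V a)
    (htop : Tendsto v atTop atTop)
    (hratio : Tendsto (fun y => v (3 / 4 * y) / v (1 / 2 * y)) atTop atTop)
    {M : ℝ} (hM : 0 ≤ M) :
    ∃ C, 0 ≤ C ∧ ∀ a z, 0 ≤ a → 2 * a ≤ z → M * z - C ≤ V z - V a - v a * (z - a) := by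
  have hhalf : Tendsto (fun y : ℝ => v (1 / 2 * y)) atTop atTop :=
    htop.comp (tendsto_id.const_mul_atTop (by norm_num))
  obtain ⟨Z, hZ⟩ := eventually_atTop.1
    ((hratio.eventually_ge_atTop 2).and (hhalf.eventually_ge_atTop (4 * M + 1)))
  refine ⟨M * max Z 0, by positivity, fun a z ha haz => ?_⟩
  have hz : 0 ≤ z := by linarith
  rcases le_total z (max Z 0) with h | h
  · have := hV a z ha hz
    have := mul_le_mul_of_nonneg_left h hM
    linarith
  · obtain ⟨hr, hb⟩ := hZ z ((le_max_left _ _).trans h)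
    have hp : 0 < v (1 / 2 * z) := by linarith
    rw [le_div_iff₀ hp] at hr
    have hav : v a ≤ v (1 / 2 * z) :=
      hm ha (mem_Ici.2 (by linarith)) (by linarith)
    have h1 := hV (3 / 4 * z) z (by linarith) hz
    have h2 := hV a (3 / 4 * z) ha (by linarith)
    have h3 : 0 ≤ M * max Z 0 := by positivity
    have h4 : 4 * M * z ≤ (v (3 / 4 * z) - v a) * z :=
      mul_le_mul_of_nonneg_right (by linarith) hz
    linarith

/-- Superlinear lower bound for the driftless sum along a nonnegative sequence. -/
theorem sum_superlinear {v V : ℝ → ℝ} (h0 : ∀ y, 0 ≤ v y) (hm : MonotoneOn v (Ici 0))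
    (hV0 : V 0 = 0)
    (hV : ∀ a z, 0 ≤ a → 0 ≤ z → v a * (z - a) ≤ V z - V a)
    (htop : Tendsto v atTop atTop)
    (hratio : Tendsto (fun y => v (3 / 4 * y) / v (1 / 2 * y)) atTop atTop)
    (n : ℕ) :
    ∀ M, 0 ≤ M → ∃ C, 0 ≤ C ∧ ∀ y : ℕ → ℝ, (∀ i, 0 ≤ y i) → ∀ i ≤ n,
      M * y i - C ≤ ∑ k ∈ Finset.range (n + 1),
        (v (y k) - if k = 0 then 0 else v (y (k - 1))) * y k - (y n * v (y n) - V (y n)) := by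
  induction n with
  | zero =>
    intro M hM
    obtain ⟨C, hC, h⟩ := bregman_superlinear hm hV htop hratio hM
    refine ⟨C, hC, fun y hy i hi => ?_⟩
    obtain rfl : i = 0 := by omega
    have h1 := h 0 (y 0) le_rfl (by simpa using hy 0)
    have h2 : 0 ≤ v 0 * y 0 := mul_nonneg (h0 0) (hy 0)
    simp only [zero_add, Finset.sum_range_one, if_true, sub_zero, hV0] at h1 ⊢
    linarith
  | succ n ih =>
    intro M hM
    obtain ⟨C, hC, h⟩ := bregman_superlinear hm hV htop hratio hM
    obtain ⟨C', hC', h'⟩ := ih (2 * M) (by positivity)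
    refine ⟨C + C', by positivity, fun y hy i hi => ?_⟩
    rw [Finset.sum_range_succ, if_neg n.succ_ne_zero, Nat.add_sub_cancel]
    have hn := h' y hy n le_rfl
    have hD := hV (y n) (y (n + 1)) (hy _) (hy _)
    have hMn := mul_nonneg hM (hy n)
    rcases Nat.lt_or_ge n i with hlt | hle
    · obtain rfl : i = n + 1 := by omega
      rcases le_total (2 * y n) (y (n + 1)) with hc | hc
      · have := h (y n) (y (n + 1)) (hy _) hc
        linarith
      · have := mul_le_mul_of_nonneg_left hc hM
        linarith
    · have := h' y hy i hle
      have := mul_nonneg hM (hy i)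
      linarith

theorem EuclideanSpace.norm_le_sum_abs {ι : Type*} [Fintype ι] (x : EuclideanSpace ℝ ι) :
    ‖x‖ ≤ ∑ i, |x i| := by
  rw [EuclideanSpace.norm_eq]
  refine Real.sqrt_le_iff.2 ⟨Finset.sum_nonneg fun i _ => abs_nonneg _, ?_⟩
  simp only [Real.norm_eq_abs]
  exact Finset.sum_sq_le_sq_sum_of_nonneg fun i _ => abs_nonneg _

/-- Lemma 3.2, second part: `β_d(x) → −∞` as `‖x‖ → ∞` within the open negative orthant. -/
theorem beta_tendsto_neg_infty_on_negative_orthant (d : ℕ) (hd : 1 ≤ d) (μ : Fin d → ℝ) (hμ : ∀ i, μ i < 0)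
    (u : ℝ → ℝ) (hu : Admissible u) :
    ∀ M > 0, ∃ R > 0, ∀ x : EuclideanSpace ℝ (Fin d), (∀ i, x i < 0) → R ≤ ‖x‖ →
      beta μ u x ≤ -M := by
  intro M hM
  obtain ⟨hc, h0, hanti, -, hbot, hratio⟩ := hu
  obtain ⟨n, rfl⟩ : ∃ n, d = n + 1 := ⟨d - 1, by omega⟩
  set v : ℝ → ℝ := fun y => u (-y) with hv
  have hm : MonotoneOn v (Ici 0) := fun a ha b hb hab =>
    hanti (by simpa using hb) (by simpa using ha) (neg_le_neg hab)
  have hvc : Continuous v := hc.comp continuous_neg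
  obtain ⟨V, hV0, hV⟩ := exists_convex_primitive hvc hm
  have hr : Tendsto (fun y => v (3 / 4 * y) / v (1 / 2 * y)) atTop atTop := by
    simpa [hv, Function.comp_def] using
      (hratio (3 / 4) (1 / 2) (by norm_num) (by norm_num)).comp tendsto_neg_atTop_atBot
  set K := ∑ i, |μ i|
  have hK : 0 ≤ K := Finset.sum_nonneg fun i _ => abs_nonneg _
  obtain ⟨C, hC, hS⟩ := sum_superlinear (v := v) (fun y => h0 (-y)) hm hV0 hV
    (hbot.comp tendsto_neg_atTop_atBot) hr n ((n + 1) * (M + 1 + K)) (by positivity)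
  refine ⟨C + 1, by positivity, fun x hx hR => ?_⟩
  have hpos : 0 < ‖x‖ := by linarith
  set y : ℕ → ℝ := fun k => if h : k < n + 1 then -x ⟨k, h⟩ else 0 with hy
  have hyx (i : Fin (n + 1)) : y i = -x i := by simp only [hy, dif_pos i.isLt, Fin.eta]
  have hy0 (i : ℕ) : 0 ≤ y i := by
    simp only [hy]
    split_ifs with h
    · exact neg_nonneg.2 (hx _).le
    · exact le_rfl
  set S := ∑ k ∈ Finset.range (n + 1), (v (y k) - if k = 0 then 0 else v (y (k - 1))) * y k with hSd
  set A := ∑ i, -x i with hA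
  have hbeta : betaSum μ u x = -S + ∑ i, μ i * x i := by
    rw [hSd, ← Fin.sum_univ_eq_sum_range
      (fun k => (v (y k) - if k = 0 then 0 else v (y (k - 1))) * y k), betaSum,
      ← Finset.sum_neg_distrib, ← Finset.sum_add_distrib]
    refine Finset.sum_congr rfl fun k _ => ?_
    have hk : (k : ℕ) - 1 < n + 1 := (Nat.sub_le _ _).trans_lt k.isLt
    have hpred : y ((k : ℕ) - 1) = -x ⟨(k : ℕ) - 1, hk⟩ := hyx ⟨_, hk⟩
    simp only [hyx, hpred, hv, neg_neg]
    ring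
  have hdrift : ∑ i, μ i * x i ≤ K * A := by
    rw [hA, Finset.mul_sum]
    refine Finset.sum_le_sum fun i _ => ?_
    have h1 : |μ i| ≤ K := Finset.single_le_sum (fun j _ => abs_nonneg (μ j)) (Finset.mem_univ i)
    have h2 := mul_le_mul_of_nonneg_right ((neg_le_abs (μ i)).trans h1) (neg_nonneg.2 (hx i).le)
    linarith
  have hnorm : ‖x‖ ≤ A :=
    (EuclideanSpace.norm_le_sum_abs x).trans_eq
      (Finset.sum_congr rfl fun i _ => abs_of_neg (hx i))
  have hG : 0 ≤ y n * v (y n) - V (y n) := by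
    have := hV (y n) 0 (hy0 n) le_rfl
    linarith
  have hSA : (M + 1 + K) * A - C ≤ S := by
    have h : ∀ i : Fin (n + 1), (n + 1) * (M + 1 + K) * (-x i) - C ≤ S := fun i => by
      have := hS y hy0 i (Nat.lt_succ_iff.1 i.isLt)
      rw [hyx] at this
      linarith
    have h2 := Finset.sum_le_sum fun i (_ : i ∈ Finset.univ) => h i
    rw [Finset.sum_sub_distrib, ← Finset.mul_sum] at h2
    simp only [Finset.sum_const, Finset.card_univ, Fintype.card_fin, nsmul_eq_mul] at h2
    push_cast at h2
    have hn : (0 : ℝ) < n + 1 := by positivity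
    refine le_of_mul_le_mul_left ?_ hn
    linarith
  rw [beta, one_div, inv_mul_le_iff₀ hpos, hbeta]
  have := mul_le_mul_of_nonneg_left hnorm hM.le
  linarith
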